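/- Let Q be a finite acyclic quiver, S, X representations with Ext¹_Q(S,X) one-dimensional spanned by a non-split extension ξ: 0 → X → Y → S → 0. A pair (N₁, N₂), with N₁ ⊆ X and N₂ ⊆ S subrepresentations, satisfies Ext¹_Q(N₂, X/N₁) ≠ 0 if and only if both Ext¹_Q(N₂, X) ≠ 0 and Ext¹_Q(S, X/N₁) ≠ 0. -/

import Mathlib

open Module

/-- A finite quiver: finite sets of vertices and arrows, with source and target maps. -/
structure FinQuiver where
  V : Type
  A : Type
  [fV : Fintype V]
  [fA : Fintype A]
  s : A → V
  t : A → V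

attribute [instance] FinQuiver.fV FinQuiver.fA

/-- A finite-dimensional complex representation of a finite quiver. -/
structure QRep (Q : FinQuiver) where
  space : Q.V → Type
  [inst_add : ∀ i, AddCommGroup (space i)]
  [inst_mod : ∀ i, Module ℂ (space i)]
  [inst_fd : ∀ i, FiniteDimensional ℂ (space i)]
  map : ∀ a : Q.A, space (Q.s a) →ₗ[ℂ] space (Q.t a)

attribute [instance] QRep.inst_add QRep.inst_mod QRep.inst_fd

variable {Q : FinQuiver}

/-- Degree-zero morphism space `Hom(e,d)`. -/
abbrev Hom0 (N M : QRep Q) := ∀ i, N.space i →ₗ[ℂ] M.space i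

/-- Degree-one morphism space `Hom(e,d[1])`. -/
abbrev Hom1 (N M : QRep Q) := ∀ a : Q.A, N.space (Q.s a) →ₗ[ℂ] M.space (Q.t a)

/-- The map `Φ^M_N : (f_i) ↦ (M_α ∘ f_{s α} − f_{t α} ∘ N_α)`. -/
def Phi (N M : QRep Q) : Hom0 N M →ₗ[ℂ] Hom1 N M where
  toFun f := fun a => (M.map a).comp (f (Q.s a)) - (f (Q.t a)).comp (N.map a)
  map_add' f g := by
    funext a; ext x; simp [LinearMap.add_comp, LinearMap.comp_add]; abel
  map_smul' c f := by
    funext a; ext x; simp [smul_sub]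

/-- `Hom_Q(N,M)` realized as the kernel of `Φ`. -/
abbrev HomQ (N M : QRep Q) : Submodule ℂ (Hom0 N M) := LinearMap.ker (Phi N M)

/-- `Ext¹_Q(N,M)` realized as the cokernel of `Φ` (valid since `Rep Q` is hereditary). -/
abbrev ExtQ (N M : QRep Q) := Hom1 N M ⧸ LinearMap.range (Phi N M)

/-- Morphisms of quiver representations. -/
abbrev QHomT (N M : QRep Q) :=
  {f : ∀ i, N.space i →ₗ[ℂ] M.space i //
    ∀ a : Q.A, (M.map a).comp (f (Q.s a)) = (f (Q.t a)).comp (N.map a)}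

/-- A subrepresentation: a family of subspaces stable under the structure maps. -/
structure SubRep (M : QRep Q) where
  carrier : ∀ i, Submodule ℂ (M.space i)
  stable : ∀ a : Q.A, ∀ x ∈ carrier (Q.s a), M.map a x ∈ carrier (Q.t a)

/-- A subrepresentation as a representation. -/
def SubRep.toRep {M : QRep Q} (N : SubRep M) : QRep Q where
  space i := N.carrier i
  map a := (M.map a).restrict (N.stable a)

/-- The quotient representation `M/N`. -/
def SubRep.quot {M : QRep Q} (N : SubRep M) : QRep Q where
  space i := M.space i ⧸ N.carrier i
  map a := Submodule.mapQ (N.carrier (Q.s a)) (N.carrier (Q.t a)) (M.map a)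
    (fun x hx => N.stable a x hx)

theorem subsingleton_extQ_iff (N M : QRep Q) :
    Subsingleton (ExtQ N M) ↔ Function.Surjective (Phi N M) := by
  rw [Submodule.Quotient.subsingleton_iff, LinearMap.range_eq_top]

/-- `Phi` commutes with postcomposition by a morphism of representations. -/
theorem Phi_postcomp {N X Z : QRep Q} (p : QHomT X Z) (f : Hom0 N X) :
    Phi N Z (fun i => (p.1 i).comp (f i)) = fun a => (p.1 (Q.t a)).comp (Phi N X f a) := by
  funext a
  change (Z.map a).comp ((p.1 (Q.s a)).comp (f (Q.s a))) -
      ((p.1 (Q.t a)).comp (f (Q.t a))).comp (N.map a) =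
    (p.1 (Q.t a)).comp ((X.map a).comp (f (Q.s a)) - (f (Q.t a)).comp (N.map a))
  rw [LinearMap.comp_sub, ← LinearMap.comp_assoc, p.2 a]
  simp only [LinearMap.comp_assoc]

/-- `Phi` commutes with precomposition by a morphism of representations. -/
theorem Phi_precomp {N S X : QRep Q} (j : QHomT N S) (f : Hom0 S X) :
    Phi N X (fun i => (f i).comp (j.1 i)) = fun a => (Phi S X f a).comp (j.1 (Q.s a)) := by
  funext a
  change (X.map a).comp ((f (Q.s a)).comp (j.1 (Q.s a))) -
      ((f (Q.t a)).comp (j.1 (Q.t a))).comp (N.map a) =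
    ((X.map a).comp (f (Q.s a)) - (f (Q.t a)).comp (S.map a)).comp (j.1 (Q.s a))
  rw [LinearMap.sub_comp, LinearMap.comp_assoc, LinearMap.comp_assoc, LinearMap.comp_assoc, j.2 a]

/-- `Ext¹(N, -)` is right exact. -/
theorem Phi_surjective_of_epi {N X Z : QRep Q} (p : QHomT X Z)
    (hp : ∀ i, Function.Surjective (p.1 i)) (h : Function.Surjective (Phi N X)) :
    Function.Surjective (Phi N Z) := by
  intro d
  choose r hr using fun i => (p.1 i).exists_rightInverse_of_surjective
    (LinearMap.range_eq_top.2 (hp i))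
  obtain ⟨f, hf⟩ := h fun a => (r (Q.t a)).comp (d a)
  refine ⟨_, (Phi_postcomp p f).trans ?_⟩
  funext a
  rw [hf, ← LinearMap.comp_assoc, hr, LinearMap.id_comp]

/-- `Ext¹(-, X)` turns monomorphisms into epimorphisms. -/
theorem Phi_surjective_of_mono {N S X : QRep Q} (j : QHomT N S)
    (hj : ∀ i, Function.Injective (j.1 i)) (h : Function.Surjective (Phi S X)) :
    Function.Surjective (Phi N X) := by
  intro d
  choose l hl using fun i => (j.1 i).exists_leftInverse_of_injective
    (LinearMap.ker_eq_bot.2 (hj i))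
  obtain ⟨f, hf⟩ := h fun a => (d a).comp (l (Q.s a))
  refine ⟨_, (Phi_precomp j f).trans ?_⟩
  funext a
  rw [hf, LinearMap.comp_assoc, hl, LinearMap.comp_id]

/-- If `Ext¹(S, X)` is one-dimensional and `Ext¹(S, Z) ≠ 0` for a quotient `p : X → Z`, then the
pushforward `Ext¹(S, X) → Ext¹(S, Z)` is injective on classes of cocycles killed by `p`. -/
theorem mem_range_Phi_of_postcomp_eq_zero {S X Z : QRep Q} (p : QHomT X Z)
    (hp : ∀ i, Function.Surjective (p.1 i)) (hgen : Module.finrank ℂ (ExtQ S X) = 1)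
    (hZ : ¬ Function.Surjective (Phi S Z)) (e : Hom1 S X)
    (he : ∀ a, (p.1 (Q.t a)).comp (e a) = 0) : e ∈ LinearMap.range (Phi S X) := by
  by_contra hne
  have hne' : (Submodule.Quotient.mk e : ExtQ S X) ≠ 0 := by
    rwa [Ne, Submodule.Quotient.mk_eq_zero]
  apply hZ
  intro d
  choose r hr using fun i => (p.1 i).exists_rightInverse_of_surjective
    (LinearMap.range_eq_top.2 (hp i))
  obtain ⟨c, hc⟩ := (finrank_eq_one_iff_of_nonzero' _ hne').1 hgen
    (Submodule.Quotient.mk fun a => (r (Q.t a)).comp (d a))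
  rw [← Submodule.Quotient.mk_smul, eq_comm, Submodule.Quotient.eq] at hc
  obtain ⟨g, hg⟩ := hc
  refine ⟨_, (Phi_postcomp p g).trans ?_⟩
  funext a
  rw [hg]
  change (p.1 (Q.t a)).comp ((r (Q.t a)).comp (d a) - c • e a) = d a
  rw [LinearMap.comp_sub, LinearMap.comp_smul, he, smul_zero, sub_zero, ← LinearMap.comp_assoc,
    hr, LinearMap.id_comp]

theorem Phi_surjective_of_mono_of_epi {N S X Z : QRep Q} (j : QHomT N S)
    (hj : ∀ i, Function.Injective (j.1 i)) (p : QHomT X Z)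
    (hp : ∀ i, Function.Surjective (p.1 i)) (hgen : Module.finrank ℂ (ExtQ S X) = 1)
    (hZ : ¬ Function.Surjective (Phi S Z)) (h : Function.Surjective (Phi N Z)) :
    Function.Surjective (Phi N X) := by
  intro d
  choose l hl using fun i => (j.1 i).exists_leftInverse_of_injective
    (LinearMap.ker_eq_bot.2 (hj i))
  choose r hr using fun i => (p.1 i).exists_rightInverse_of_surjective
    (LinearMap.range_eq_top.2 (hp i))
  obtain ⟨f, hf⟩ := h fun a => (p.1 (Q.t a)).comp (d a)
  let f' : Hom0 N X := fun i => (r i).comp (f i)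
  have hf' : (fun i => (p.1 i).comp (f' i)) = f := by
    funext i
    rw [← LinearMap.comp_assoc, hr, LinearMap.id_comp]
  have hpd : ∀ a, (p.1 (Q.t a)).comp (d a - Phi N X f' a) = 0 := fun a => by
    have := congrFun (Phi_postcomp p f') a
    rw [hf', hf] at this
    rw [LinearMap.comp_sub, ← this, sub_self]
  obtain ⟨g, hg⟩ := mem_range_Phi_of_postcomp_eq_zero p hp hgen hZ
    (fun a => (d a - Phi N X f' a).comp (l (Q.s a)))
    (fun a => by rw [← LinearMap.comp_assoc, hpd, LinearMap.zero_comp])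
  refine ⟨f' + fun i => (g i).comp (j.1 i), ?_⟩
  rw [map_add, Phi_precomp, hg]
  funext a
  rw [Pi.add_apply, LinearMap.comp_assoc, hl, LinearMap.comp_id, add_sub_cancel]

/-- The inclusion of a subrepresentation. -/
def SubRep.incl {M : QRep Q} (N : SubRep M) : QHomT N.toRep M :=
  ⟨fun i => (N.carrier i).subtype, fun _ => rfl⟩

/-- The projection onto the quotient by a subrepresentation. -/
def SubRep.proj {M : QRep Q} (N : SubRep M) : QHomT M N.quot :=
  ⟨fun i => (N.carrier i).mkQ, fun _ => rfl⟩

theorem SubRep.incl_injective {M : QRep Q} (N : SubRep M) (i : Q.V) :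
    Function.Injective (N.incl.1 i) :=
  (N.carrier i).injective_subtype

theorem SubRep.proj_surjective {M : QRep Q} (N : SubRep M) (i : Q.V) :
    Function.Surjective (N.proj.1 i) :=
  (N.carrier i).mkQ_surjective

/-- if `Ext¹_Q(S,X)` is one-dimensional (spanned by a non-split
extension `ξ : 0 → X → Y → S → 0`) then for subrepresentations `N₁ ⊆ X`, `N₂ ⊆ S`,
`Ext¹_Q(N₂, X/N₁) ≠ 0` iff both `Ext¹_Q(N₂, X) ≠ 0` and `Ext¹_Q(S, X/N₁) ≠ 0`. -/
theorem generating_extension_image_criterion (Q : FinQuiver) (S X : QRep Q)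
    (hgen : Module.finrank ℂ (ExtQ S X) = 1)
    (N₁ : SubRep X) (N₂ : SubRep S) :
    ¬ Subsingleton (ExtQ N₂.toRep N₁.quot) ↔
      (¬ Subsingleton (ExtQ N₂.toRep X) ∧ ¬ Subsingleton (ExtQ S N₁.quot)) := by
  simp only [subsingleton_extQ_iff]
  refine ⟨fun h => ⟨fun h' => h (Phi_surjective_of_epi N₁.proj N₁.proj_surjective h'),
    fun h' => h (Phi_surjective_of_mono N₂.incl N₂.incl_injective h')⟩, fun ⟨h₁, h₂⟩ h => h₁ ?_⟩
  exact Phi_surjective_of_mono_of_epi N₂.incl N₂.incl_injective N₁.proj N₁.proj_surjective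
    hgen h₂ h
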